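/- arXiv:1809.00548 — 4 statements merged into one kernel-verified Lean document; each statement's English description precedes it below -/
import Mathlib

section
/- The binary operation ⊕ on S^lay is associative: for all q, q', q'' ∈ S^lay, (q ⊕ q') ⊕ q'' = q ⊕ (q' ⊕ q''). -/
open scoped NNReal Classical

/-- The set `S^lay = Stay ∪ Change ∪ {infeasible}`. -/
inductive Slay : Type where
  | st : ℝ≥0 → Slay
  | ch : ℝ≥0 → ℝ≥0 → Slay
  | infeasible : Slay

namespace Slay

/-- The binary operation `⊕` on `S^lay`, with minimum layer duration `τ`. -/
noncomputable def op (τ : ℝ) : Slay → Slay → Slay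
  | st a, st b => st (a + b)
  | st a, ch x y => ch (a + x) y
  | ch x y, st a => ch x (y + a)
  | ch x y, ch u v => if (y : ℝ) + (u : ℝ) < τ then infeasible else ch x v
  | infeasible, _ => infeasible
  | _, infeasible => infeasible

/-- The binary operation `⊕` on `S^lay` is associative. -/
theorem op_assoc (τ : ℝ) (hτ : 0 ≤ τ) :
    ∀ q q' q'' : Slay, op τ (op τ q q') q'' = op τ q (op τ q' q'') := by
  rintro (a | ⟨x, y⟩ | _) (b | ⟨u, v⟩ | _) (c | ⟨w, z⟩ | _) <;>
    simp only [op, NNReal.coe_add, add_assoc] <;> split_ifs <;>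
    simp only [op, if_true, if_false, *]

end Slay
end

section
/- In the partially ordered set (S^lay, ⪯), any two elements q and q' admit a greatest lower bound q ∧ q', given by: st(a) ∧ st(b) = st(max(a,b)); st(a) ∧ ch(x,y) = ch(x,y) ∧ st(a) = st(max(a,x,y)); ch(x,y) ∧ ch(u,v) = ch(max(x,u), max(y,v)); infeasible ∧ st(a) = st(a) ∧ infeasible = st(a); and ch(x,y) ∧ infeasible = infeasible ∧ ch(x,y) = ch(x,y). That is, each right-hand side is a lower bound of the pair with respect to ⪯, and any common lower bound of the pair is ⪯ the right-hand side. -/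
open scoped NNReal

namespace Slay
/-- The partial order `⪯` on `S^lay`. -/
def le : Slay → Slay → Prop
  | _, infeasible => True
  | st a, st b => b ≤ a
  | st a, ch x y => x ≤ a ∧ y ≤ a
  | ch _ _, st _ => False
  | ch x y, ch u v => u ≤ x ∧ v ≤ y
  | infeasible, _ => False

/-- The meet operation `∧` on `S^lay`. -/
def meet : Slay → Slay → Slay
  | st a, st b => st (max a b)
  | st a, ch x y => st (max a (max x y))
  | ch x y, st a => st (max a (max x y))
  | ch x y, ch u v => ch (max x u) (max y v)
  | infeasible, q => q
  | q, infeasible => q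

/-- In `(S^lay, ⪯)`, any two elements `q, q'` admit a greatest lower bound, given by `meet`:
`meet q q'` is a lower bound of the pair, and any common lower bound is `⪯ meet q q'`. -/
theorem meet_isGLB (q q' : Slay) :
    le (meet q q') q ∧ le (meet q q') q' ∧
    ∀ r : Slay, le r q → le r q' → le r (meet q q') := by
  refine ⟨?_, ?_, fun r => ?_⟩
  · cases q <;> cases q' <;> simp [le, meet]
  · cases q <;> cases q' <;> simp [le, meet]
  · cases q <;> cases q' <;> cases r <;> simp +contextual [le, meet]

end Slay
end

section
/- Let ℓ = (e_1, …, e_k) be a nonempty finite sequence where each e_i is either st(d_i) with d_i ∈ ℝ≥0 or ch(0,0), and let q = e_1 ⊕ e_2 ⊕ ⋯ ⊕ e_k be its fold in S^lay. Then exactly one of the following holds: (i) no e_i equals ch(0,0) and q = st(d_1 + ⋯ + d_k); (ii) q = infeasible; (iii) at least one e_i equals ch(0,0) and q = ch(x, y), where x is the sum of the values d_i over the indices i strictly before the first index at which ch(0,0) occurs, and y is the sum of the values d_i over the indices i strictly after the last index at which ch(0,0) occurs. -/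
open scoped NNReal Classical

namespace Slay

/-- Encoding of sequence elements: `some d` stands for `st d`, `none` for `ch 0 0`. -/
def toSlay : Option ℝ≥0 → Slay
  | some d => st d
  | none => ch 0 0

theorem takeWhile_isSome_append_of_mem {α : Type*} {l : List (Option α)} (h : none ∈ l)
    (l' : List (Option α)) :
    (l ++ l').takeWhile Option.isSome = l.takeWhile Option.isSome := by
  induction l with
  | nil => simp at h
  | cons b l ih => cases b <;> simp_all

theorem takeWhile_isSome_append_none_of_notMem {α : Type*} {l : List (Option α)}
    (h : none ∉ l) : (l ++ [none]).takeWhile Option.isSome = l := by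
  induction l with
  | nil => simp
  | cons b l ih => cases b <;> simp_all

theorem foldl_op_cases (τ : ℝ) (e : Option ℝ≥0) (l : List (Option ℝ≥0)) :
    (l.map toSlay).foldl (op τ) (toSlay e) = infeasible ∨
    (none ∉ e :: l ∧
      (l.map toSlay).foldl (op τ) (toSlay e) = st ((e :: l).filterMap id).sum) ∨
    (none ∈ e :: l ∧ (l.map toSlay).foldl (op τ) (toSlay e) =
      ch (((e :: l).takeWhile Option.isSome).filterMap id).sum
        (((e :: l).reverse.takeWhile Option.isSome).filterMap id).sum) := by
  induction l using List.reverseRecOn with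
  | nil => cases e <;> simp [-ENNReal.none_eq_top, -ENNReal.some_eq_coe, toSlay]
  | append_singleton l a ih =>
    rw [List.map_append, List.foldl_append, ← List.cons_append]
    simp only [List.map_cons, List.map_nil, List.foldl_cons, List.foldl_nil]
    generalize (l.map toSlay).foldl (op τ) (toSlay e) = q at ih ⊢
    generalize e :: l = m at ih ⊢
    rcases ih with rfl | ⟨h, rfl⟩ | ⟨h, rfl⟩
    · exact Or.inl (by cases a <;> rfl)
    · cases a with
      | some d =>
        exact Or.inr (Or.inl (by
          simp [-ENNReal.none_eq_top, -ENNReal.some_eq_coe, h, toSlay, op]))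
      | none =>
        refine Or.inr (Or.inr ⟨by simp [-ENNReal.none_eq_top, -ENNReal.some_eq_coe], ?_⟩)
        rw [takeWhile_isSome_append_none_of_notMem h]
        simp [-ENNReal.none_eq_top, -ENNReal.some_eq_coe, toSlay, op]
    · cases a with
      | some d =>
        refine Or.inr (Or.inr ⟨by simp [-ENNReal.none_eq_top, -ENNReal.some_eq_coe, h], ?_⟩)
        rw [takeWhile_isSome_append_of_mem h]
        simp [-ENNReal.none_eq_top, -ENNReal.some_eq_coe, toSlay, op, add_comm]
      | none =>
        simp only [toSlay, op]
        split_ifs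
        · exact Or.inl rfl
        · refine Or.inr (Or.inr ⟨by simp [-ENNReal.none_eq_top, -ENNReal.some_eq_coe], ?_⟩)
          rw [takeWhile_isSome_append_of_mem h]
          simp [-ENNReal.none_eq_top, -ENNReal.some_eq_coe]

/-- Let `ℓ = (e_1, …, e_k)` be a nonempty sequence where each `e_i` is `st d_i` or `ch 0 0`,
and let `q = e_1 ⊕ ⋯ ⊕ e_k`. Then exactly one of the following holds:
(i) no `e_i` is `ch 0 0` and `q = st (d_1 + ⋯ + d_k)`; (ii) `q = infeasible`;
(iii) some `e_i` is `ch 0 0` and `q = ch x y` where `x` is the sum of the `d_i` strictly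
before the first `ch 0 0` and `y` the sum of the `d_i` strictly after the last `ch 0 0`. -/
theorem fold_trichotomy (τ : ℝ) (hτ : 0 ≤ τ) (e : Option ℝ≥0) (l : List (Option ℝ≥0)) :
    let ℓ : List (Option ℝ≥0) := e :: l
    let q : Slay := (l.map toSlay).foldl (op τ) (toSlay e)
    let C1 : Prop := none ∉ ℓ ∧ q = st (ℓ.filterMap id).sum
    let C2 : Prop := q = infeasible
    let C3 : Prop := none ∈ ℓ ∧
      q = ch ((ℓ.takeWhile Option.isSome).filterMap id).sum
             ((ℓ.reverse.takeWhile Option.isSome).filterMap id).sum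
    (C1 ∧ ¬C2 ∧ ¬C3) ∨ (¬C1 ∧ C2 ∧ ¬C3) ∨ (¬C1 ∧ ¬C2 ∧ C3) := by
  intro ℓ q C1 C2 C3
  rcases foldl_op_cases τ e l with h | h | h
  · have h2 : C2 := h
    exact Or.inr (Or.inl ⟨fun h1 => (nomatch h1.2.symm.trans h2), h2,
      fun h3 => (nomatch h3.2.symm.trans h2)⟩)
  · exact Or.inl ⟨h, fun h2 => (nomatch h.2.symm.trans h2), fun h3 => h.1 h3.1⟩
  · exact Or.inr (Or.inr ⟨fun h1 => h1.1 h.1, fun h2 => (nomatch h.2.symm.trans h2), h⟩)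

end Slay
end

section
/- Let ℓ = (e_1, …, e_k) be a nonempty finite sequence where each e_i is either st(d_i) with d_i ∈ ℝ≥0 or ch(0,0), and let q = e_1 ⊕ e_2 ⊕ ⋯ ⊕ e_k be its fold in S^lay. Then q = infeasible if and only if there exist indices i < j such that e_i = ch(0,0), e_j = ch(0,0), no e_m with i < m < j equals ch(0,0), and the sum of the values d_m over indices m with i < m < j is strictly less than τ. Equivalently, ρ^lay(q) = 0 if and only if between any two consecutive occurrences of ch(0,0) in ℓ the total of the st-durations is at least τ (the minimum layer duration constraint). -/
open scoped NNReal Classical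

namespace Slay

/-- The infeasibility map `ρ^lay : S^lay → {0,1}`. -/
def rho : Slay → ℕ
  | infeasible => 1
  | st _ => 0
  | ch _ _ => 0

/-- The first `none` in the list is reached with accumulated duration less than `τ`, when the
accumulation starts from `y`. -/
def ShortUntilChange (τ : ℝ) (y : ℝ≥0) (l : List (Option ℝ≥0)) : Prop :=
  ∃ j : ℕ, l[j]? = some none ∧ (∀ m : ℕ, m < j → l[m]? ≠ some none) ∧
    ((y + ((l.take j).filterMap id).sum : ℝ≥0) : ℝ) < τ

/-- Two consecutive occurrences of `none` enclose a total duration less than `τ`. -/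
def HasShortLayer (τ : ℝ) (l : List (Option ℝ≥0)) : Prop :=
  ∃ i j : ℕ, i < j ∧ j < l.length ∧ l[i]? = some none ∧ l[j]? = some none ∧
    (∀ m : ℕ, i < m → m < j → l[m]? ≠ some none) ∧
    (((((l.drop (i + 1)).take (j - i - 1)).filterMap id).sum : ℝ≥0) : ℝ) < τ

theorem not_shortUntilChange_nil (τ : ℝ) (y : ℝ≥0) : ¬ ShortUntilChange τ y [] := by
  simp [ShortUntilChange]

theorem shortUntilChange_none_cons (τ : ℝ) (y : ℝ≥0) (l : List (Option ℝ≥0)) :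
    ShortUntilChange τ y (none :: l) ↔ (y : ℝ) < τ := by
  constructor
  · rintro ⟨j, -, hm, h⟩
    rcases j with _ | j
    · simpa using h
    · exact absurd rfl (hm 0 (by omega))
  · intro h
    exact ⟨0, rfl, by simp, by simpa using h⟩

theorem shortUntilChange_some_cons (τ : ℝ) (y d : ℝ≥0) (l : List (Option ℝ≥0)) :
    ShortUntilChange τ y (some d :: l) ↔ ShortUntilChange τ (y + d) l := by
  constructor
  · rintro ⟨j, hj, hm, h⟩
    rcases j with _ | j
    · simp [-ENNReal.some_eq_coe, -ENNReal.none_eq_top] at hj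
    · refine ⟨j, by simpa [-ENNReal.some_eq_coe, -ENNReal.none_eq_top] using hj,
        fun m hmj => ?_, ?_⟩
      · simpa [-ENNReal.some_eq_coe, -ENNReal.none_eq_top] using hm (m + 1) (by omega)
      · simpa [-ENNReal.some_eq_coe, -ENNReal.none_eq_top, add_assoc] using h
  · rintro ⟨j, hj, hm, h⟩
    refine ⟨j + 1, by simpa [-ENNReal.some_eq_coe, -ENNReal.none_eq_top] using hj,
        fun m hmj => ?_, ?_⟩
    · rcases m with _ | m
      · simp [-ENNReal.some_eq_coe, -ENNReal.none_eq_top]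
      · simpa [-ENNReal.some_eq_coe, -ENNReal.none_eq_top] using hm m (by omega)
    · simpa [-ENNReal.some_eq_coe, -ENNReal.none_eq_top, add_assoc] using h

theorem not_hasShortLayer_nil (τ : ℝ) : ¬ HasShortLayer τ [] := by
  simp [HasShortLayer]

theorem hasShortLayer_cons (τ : ℝ) (a : Option ℝ≥0) (l : List (Option ℝ≥0)) :
    HasShortLayer τ (a :: l) ↔ (a = none ∧ ShortUntilChange τ 0 l) ∨ HasShortLayer τ l := by
  constructor
  · rintro ⟨i, j, hij, hjl, hi, hj, hm, h⟩
    obtain ⟨j, rfl⟩ : ∃ k, j = k + 1 := ⟨j - 1, by omega⟩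
    rcases i with _ | i
    · refine Or.inl ⟨by simpa [-ENNReal.some_eq_coe, -ENNReal.none_eq_top] using hi, j,
        by simpa [-ENNReal.some_eq_coe, -ENNReal.none_eq_top] using hj,
        fun m hmj => ?_, ?_⟩
      · simpa using hm (m + 1) (by omega) (by omega)
      · simpa using h
    · refine Or.inr ⟨i, j, by omega, by simpa using hjl, by simpa using hi, by simpa using hj,
        fun m him hmj => ?_, ?_⟩
      · simpa using hm (m + 1) (by omega) (by omega)
      · simpa [Nat.add_sub_add_right] using h
  · rintro (⟨rfl, j, hj, hm, h⟩ | ⟨i, j, hij, hjl, hi, hj, hm, h⟩)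
    · refine ⟨0, j + 1, by omega, ?_, rfl,
        by simpa [-ENNReal.some_eq_coe, -ENNReal.none_eq_top] using hj,
        fun m him hmj => ?_, ?_⟩
      · have := (List.getElem?_eq_some_iff.mp hj).1
        simpa [-ENNReal.some_eq_coe, -ENNReal.none_eq_top] using this
      · obtain ⟨m, rfl⟩ : ∃ k, m = k + 1 := ⟨m - 1, by omega⟩
        simpa [-ENNReal.some_eq_coe, -ENNReal.none_eq_top] using hm m (by omega)
      · simpa [-ENNReal.some_eq_coe, -ENNReal.none_eq_top] using h
    · refine ⟨i + 1, j + 1, by omega, by simpa using hjl, by simpa using hi, by simpa using hj,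
        fun m him hmj => ?_, ?_⟩
      · obtain ⟨m, rfl⟩ : ∃ k, m = k + 1 := ⟨m - 1, by omega⟩
        simpa using hm m (by omega) (by omega)
      · simpa [Nat.add_sub_add_right] using h

theorem foldl_op_infeasible (τ : ℝ) (l : List Slay) :
    l.foldl (op τ) infeasible = infeasible := by
  induction l with
  | nil => rfl
  | cons a l ih => simpa [op] using ih

theorem foldl_op_ch_eq_infeasible_iff (τ : ℝ) (x y : ℝ≥0) (l : List (Option ℝ≥0)) :
    (l.map toSlay).foldl (op τ) (ch x y) = infeasible ↔
      ShortUntilChange τ y l ∨ HasShortLayer τ l := by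
  induction l generalizing y with
  | nil => simp [not_shortUntilChange_nil, not_hasShortLayer_nil]
  | cons a l ih =>
    rcases a with _ | d
    · by_cases h : (y : ℝ) < τ
      · simp [-ENNReal.some_eq_coe, -ENNReal.none_eq_top,
          toSlay, op, h, foldl_op_infeasible, shortUntilChange_none_cons]
      · simp [-ENNReal.some_eq_coe, -ENNReal.none_eq_top,
          toSlay, op, h, ih, shortUntilChange_none_cons, hasShortLayer_cons]
    · simp [-ENNReal.some_eq_coe, -ENNReal.none_eq_top,
        toSlay, op, ih, shortUntilChange_some_cons, hasShortLayer_cons]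

theorem foldl_op_st_eq_infeasible_iff (τ : ℝ) (a : ℝ≥0) (l : List (Option ℝ≥0)) :
    (l.map toSlay).foldl (op τ) (st a) = infeasible ↔ HasShortLayer τ l := by
  induction l generalizing a with
  | nil => simp [not_hasShortLayer_nil]
  | cons b l ih =>
    rcases b with _ | d
    · simp [-ENNReal.some_eq_coe, -ENNReal.none_eq_top,
        toSlay, op, foldl_op_ch_eq_infeasible_iff, hasShortLayer_cons]
    · simp [-ENNReal.some_eq_coe, -ENNReal.none_eq_top, toSlay, op, ih, hasShortLayer_cons]

theorem rho_eq_zero_iff (q : Slay) : rho q = 0 ↔ q ≠ infeasible := by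
  cases q <;> simp [rho]

/-- Let `ℓ = (e_1, …, e_k)` be a nonempty sequence where each `e_i` is `st d_i` or `ch 0 0`,
and let `q = e_1 ⊕ ⋯ ⊕ e_k`. Then `q = infeasible` iff there are indices `i < j` with
`e_i = ch 0 0`, `e_j = ch 0 0`, no `e_m = ch 0 0` for `i < m < j`, and the sum of the `d_m`
for `i < m < j` strictly less than `τ`. Equivalently, `ρ^lay q = 0` iff between any two
consecutive occurrences of `ch 0 0` the total of the `st`-durations is at least `τ`
(the minimum layer duration constraint). -/
theorem fold_infeasible_iff (τ : ℝ) (hτ : 0 ≤ τ) (e : Option ℝ≥0) (l : List (Option ℝ≥0)) :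
    let ℓ : List (Option ℝ≥0) := e :: l
    let q : Slay := (l.map toSlay).foldl (op τ) (toSlay e)
    (q = infeasible ↔
      ∃ i j : ℕ, i < j ∧ j < ℓ.length ∧ ℓ[i]? = some none ∧ ℓ[j]? = some none ∧
        (∀ m : ℕ, i < m → m < j → ℓ[m]? ≠ some none) ∧
        (((((ℓ.drop (i + 1)).take (j - i - 1)).filterMap id).sum : ℝ≥0) : ℝ) < τ) ∧
    (rho q = 0 ↔
      ∀ i j : ℕ, i < j → j < ℓ.length → ℓ[i]? = some none → ℓ[j]? = some none →
        (∀ m : ℕ, i < m → m < j → ℓ[m]? ≠ some none) →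
        τ ≤ (((((ℓ.drop (i + 1)).take (j - i - 1)).filterMap id).sum : ℝ≥0) : ℝ)) := by
  intro ℓ q
  have key : q = infeasible ↔ HasShortLayer τ ℓ := by
    rcases e with _ | d
    · simp [-ENNReal.some_eq_coe, -ENNReal.none_eq_top,
        q, ℓ, toSlay, foldl_op_ch_eq_infeasible_iff, hasShortLayer_cons]
    · simp [-ENNReal.some_eq_coe, -ENNReal.none_eq_top,
        q, ℓ, toSlay, foldl_op_st_eq_infeasible_iff, hasShortLayer_cons]
  refine ⟨key, ?_⟩
  rw [rho_eq_zero_iff, Ne, key]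
  simp only [HasShortLayer, not_exists, not_and, not_lt]

end Slay
end
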